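/- ∫₀^∞ tanh(z)⁵/z⁵ dz = 31 ζ(5)/π⁴ - 3175 ζ(7)/π⁶ + 35770 ζ(9)/π⁸. -/

import Mathlib

open Real MeasureTheory

open Filter Topology

/-- The sum of a series over the odd indices, from the sum over all positive indices and the sum
over the even ones. -/
lemma hasSum_odd_of_hasSum_succ {f : ℕ → ℝ} {A B : ℝ} (hA : HasSum (fun n => f (n + 1)) A)
    (hB : HasSum (fun n => f (2 * (n + 1))) B) : HasSum (fun k => f (2 * k + 1)) (A - B) := by
  have hs : Summable (fun k => f (2 * k + 1)) :=
    hA.summable.comp_injective (i := fun k => 2 * k) fun a b h => by simpa using h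
  have h := HasSum.even_add_odd (f := fun n => f (n + 1)) hs.hasSum hB
  rw [hA.unique h, add_sub_cancel_right]
  exact hs.hasSum

/-- `∑ 1 / (2k+1)^m` in terms of `∑ 1 / n^m`. -/
lemma hasSum_one_div_odd_pow {m : ℕ} (hm : m ≠ 0) {A : ℝ}
    (hA : HasSum (fun n : ℕ => 1 / (n : ℝ) ^ m) A) :
    HasSum (fun k : ℕ => 1 / (2 * (k : ℝ) + 1) ^ m) (A * (1 - 1 / 2 ^ m)) := by
  have h1 : HasSum (fun n : ℕ => 1 / ((n + 1 : ℕ) : ℝ) ^ m) A := by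
    rw [hasSum_nat_add_iff (f := fun n : ℕ => 1 / (n : ℝ) ^ m) 1]
    simpa [hm] using hA
  have h2 : HasSum (fun n : ℕ => 1 / ((2 * (n + 1) : ℕ) : ℝ) ^ m) (1 / 2 ^ m * A) := by
    convert! h1.mul_left (1 / 2 ^ m : ℝ) using 2 with n
    push_cast
    rw [mul_pow]
    field_simp
  convert! hasSum_odd_of_hasSum_succ (f := fun n : ℕ => 1 / (n : ℝ) ^ m) h1 h2 using 1
  · ext k
    push_cast
    rfl
  · ring

/-- The Mittag-Leffler expansion of the hyperbolic cotangent. -/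
lemma hasSum_coth {z : ℝ} (hz : z ≠ 0) :
    HasSum (fun n : ℕ => 2 * z / (z ^ 2 + ((n + 1 : ℕ) * π) ^ 2)) (cosh z / sinh z - 1 / z) := by
  have hπ : (π : ℂ) ≠ 0 := by exact_mod_cast pi_ne_zero
  have hzc : (z : ℂ) ≠ 0 := by exact_mod_cast hz
  have hx : (z / π * Complex.I : ℂ) ∈ Complex.integerComplement := by
    rintro ⟨n, hn⟩
    have := congrArg Complex.im hn
    rw [← Complex.ofReal_div] at this
    exact div_ne_zero hz pi_ne_zero (by simpa using this.symm)
  have h := (summable_cotTerm hx).hasSum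
  have hS : ∑' n : ℕ, cotTerm (z / π * Complex.I : ℂ) n =
      π * Complex.cot (π * (z / π * Complex.I)) - 1 / (z / π * Complex.I) :=
    (cot_series_rep' hx).symm
  rw [hS] at h
  have h' := h.mul_left (Complex.I / π)
  rw [← Complex.hasSum_ofReal]
  convert! h' using 1
  · ext n
    rw [cotTerm_identity hx]
    have hne : (z : ℂ) ^ 2 + ((n + 1) * π) ^ 2 ≠ 0 := by
      have : z ^ 2 + ((n + 1) * π) ^ 2 ≠ 0 := by positivity
      exact_mod_cast this
    have hmul : (z / π * Complex.I + (n + 1)) * (z / π * Complex.I - (n + 1)) =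
        -(((z : ℂ) ^ 2 + ((n + 1) * π) ^ 2) / π ^ 2) := by
      field_simp
      linear_combination (z : ℂ) ^ 2 * Complex.I_sq
    rw [hmul]
    push_cast
    field_simp
    rw [Complex.I_sq]
    ring
  · have hsh : Complex.sinh z ≠ 0 := by
      have : sinh z ≠ 0 := by simpa using hz
      exact_mod_cast this
    have e : (π : ℂ) * (z / π * Complex.I) = z * Complex.I := by field_simp
    rw [e, Complex.cot, Complex.cos_mul_I, Complex.sin_mul_I]
    push_cast
    field_simp

/-- The positive imaginary parts `(k + 1/2) π` of the poles of `tanh`. -/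
noncomputable def tanhPole (k : ℕ) : ℝ := (2 * k + 1) * π / 2

lemma one_le_tanhPole (k : ℕ) : 1 ≤ tanhPole k := by
  unfold tanhPole
  have := pi_gt_three
  have : (0 : ℝ) ≤ k := by positivity
  nlinarith

lemma tanhPole_pos (k : ℕ) : 0 < tanhPole k := one_pos.trans_le (one_le_tanhPole k)

lemma hasSum_tanh {z : ℝ} (hz : z ≠ 0) :
    HasSum (fun k : ℕ => 2 * z / (z ^ 2 + tanhPole k ^ 2)) (tanh z) := by
  have h1 := (hasSum_coth (mul_ne_zero two_ne_zero hz)).mul_left 2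
  have h2 : HasSum (fun n : ℕ => 2 * (2 * (2 * z) / ((2 * z) ^ 2 + ((2 * (n + 1) : ℕ) * π) ^ 2)))
      (cosh z / sinh z - 1 / z) := by
    convert! hasSum_coth hz using 2 with n
    push_cast
    field_simp
  convert! hasSum_odd_of_hasSum_succ
    (f := fun n : ℕ => 2 * (2 * (2 * z) / ((2 * z) ^ 2 + (n * π) ^ 2))) h1 h2 using 1
  · ext k
    have := tanhPole_pos k
    unfold tanhPole at *
    push_cast
    field_simp
  · have hs : sinh z ≠ 0 := by simpa using hz
    have hc := (cosh_pos z).ne'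
    rw [cosh_two_mul, sinh_two_mul, tanh_eq_sinh_div_cosh]
    field_simp
    ring

lemma hasSum_one_div_tanhPole_pow {m : ℕ} (hm : m ≠ 0) {A : ℝ}
    (hA : HasSum (fun n : ℕ => 1 / (n : ℝ) ^ m) A) :
    HasSum (fun k => 1 / tanhPole k ^ m) (A * (2 ^ m - 1) / π ^ m) := by
  convert! (hasSum_one_div_odd_pow hm hA).mul_left (2 ^ m / π ^ m) using 1
  · ext k
    unfold tanhPole
    rw [div_pow, mul_pow]
    field_simp
  · field_simp

lemma summable_one_div_tanhPole_pow {m : ℕ} (hm : 1 < m) :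
    Summable (fun k => 1 / tanhPole k ^ m) :=
  (hasSum_one_div_tanhPole_pow (by lia) (summable_one_div_nat_pow.2 hm).hasSum).summable

/-- The remainders in the odd Taylor expansions of `tanh` at `0`, up to sign. -/
noncomputable def tanhRem (j : ℕ) (z : ℝ) : ℝ :=
  ∑' k, 2 / (tanhPole k ^ (2 * j) * (z ^ 2 + tanhPole k ^ 2))

lemma tanhRem_term_le (j k : ℕ) (z : ℝ) :
    2 / (tanhPole k ^ (2 * j) * (z ^ 2 + tanhPole k ^ 2)) ≤
      2 * (1 / tanhPole k ^ (2 * (j + 1))) := by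
  have := tanhPole_pos k
  rw [mul_one_div, mul_add 2, mul_one, pow_add]
  gcongr
  nlinarith [sq_nonneg z]

lemma tanhRem_term_nonneg (j k : ℕ) (z : ℝ) :
    0 ≤ 2 / (tanhPole k ^ (2 * j) * (z ^ 2 + tanhPole k ^ 2)) := by
  have := tanhPole_pos k
  positivity

lemma summable_tanhRem (j : ℕ) (z : ℝ) :
    Summable (fun k => 2 / (tanhPole k ^ (2 * j) * (z ^ 2 + tanhPole k ^ 2))) :=
  .of_nonneg_of_le (tanhRem_term_nonneg j · z) (tanhRem_term_le j · z)
    ((summable_one_div_tanhPole_pow (by lia)).mul_left 2)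

lemma continuous_tanhRem (j : ℕ) : Continuous (tanhRem j) := by
  refine continuous_tsum (fun k => ?_)
    ((summable_one_div_tanhPole_pow (m := 2 * (j + 1)) (by lia)).mul_left 2) fun k z => ?_
  · have := tanhPole_pos k
    refine continuous_const.div (by fun_prop) fun z => by positivity
  · rw [norm_of_nonneg (tanhRem_term_nonneg j k z)]
    exact tanhRem_term_le j k z

lemma tanhRem_nonneg (j : ℕ) (z : ℝ) : 0 ≤ tanhRem j z :=
  tsum_nonneg (tanhRem_term_nonneg j · z)

lemma tanh_eq_mul_tanhRem (z : ℝ) : tanh z = z * tanhRem 0 z := by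
  rcases eq_or_ne z 0 with rfl | hz
  · simp
  · rw [← (hasSum_tanh hz).tsum_eq, tanhRem, ← tsum_mul_left]
    congr with k
    rw [mul_zero, pow_zero, one_mul]
    ring

lemma tanhRem_eq_sub (j : ℕ) (z : ℝ) {S : ℝ}
    (hS : HasSum (fun k => 1 / tanhPole k ^ (2 * (j + 1))) S) :
    tanhRem j z = 2 * S - z ^ 2 * tanhRem (j + 1) z := by
  rw [tanhRem, tanhRem,
    ← ((hS.mul_left 2).sub ((summable_tanhRem (j + 1) z).hasSum.mul_left (z ^ 2))).tsum_eq]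
  congr with k
  have := tanhPole_pos k
  field_simp
  ring

lemma bernoulli_six : bernoulli 6 = 1 / 42 := by
  have h5 : bernoulli' 5 = 0 := bernoulli'_eq_zero_of_odd (by decide) (by decide)
  have h1 : Nat.choose 6 2 = 15 := by decide
  have h2 : Nat.choose 6 4 = 15 := by decide
  rw [bernoulli_eq_bernoulli'_of_ne_one (by decide), bernoulli'_def]
  norm_num [Finset.sum_range_succ, h1, h2, h5]

lemma bernoulli_eight : bernoulli 8 = -1 / 30 := by
  have h5 : bernoulli' 5 = 0 := bernoulli'_eq_zero_of_odd (by decide) (by decide)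
  have h7 : bernoulli' 7 = 0 := bernoulli'_eq_zero_of_odd (by decide) (by decide)
  have h6 : bernoulli' 6 = 1 / 42 := by
    rw [← bernoulli_eq_bernoulli'_of_ne_one (by decide), bernoulli_six]
  have h1 : Nat.choose 8 2 = 28 := by decide
  have h2 : Nat.choose 8 4 = 70 := by decide
  have h3 : Nat.choose 8 6 = 28 := by decide
  rw [bernoulli_eq_bernoulli'_of_ne_one (by decide), bernoulli'_def]
  norm_num [Finset.sum_range_succ, h1, h2, h3, h5, h6, h7]

lemma hasSum_zeta_six : HasSum (fun n : ℕ => 1 / (n : ℝ) ^ 6) (π ^ 6 / 945) := by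
  convert! hasSum_zeta_nat (k := 3) (by decide) using 1
  norm_num [bernoulli_six, Nat.factorial]
  ring

lemma hasSum_zeta_eight : HasSum (fun n : ℕ => 1 / (n : ℝ) ^ 8) (π ^ 8 / 9450) := by
  convert! hasSum_zeta_nat (k := 4) (by decide) using 1
  norm_num [bernoulli_eight, Nat.factorial]
  ring

lemma tanhRem_zero_eq (z : ℝ) : tanhRem 0 z = 1 - z ^ 2 * tanhRem 1 z := by
  rw [tanhRem_eq_sub 0 z (hasSum_one_div_tanhPole_pow two_ne_zero hasSum_zeta_two)]
  field_simp
  ring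

lemma tanhRem_one_eq (z : ℝ) : tanhRem 1 z = 1 / 3 - z ^ 2 * tanhRem 2 z := by
  rw [tanhRem_eq_sub 1 z (hasSum_one_div_tanhPole_pow four_ne_zero hasSum_zeta_four)]
  field_simp
  ring

lemma tanhRem_two_eq (z : ℝ) : tanhRem 2 z = 2 / 15 - z ^ 2 * tanhRem 3 z := by
  rw [tanhRem_eq_sub 2 z (hasSum_one_div_tanhPole_pow (by decide) hasSum_zeta_six)]
  field_simp
  ring

lemma tanhRem_three_eq (z : ℝ) : tanhRem 3 z = 17 / 315 - z ^ 2 * tanhRem 4 z := by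
  rw [tanhRem_eq_sub 3 z (hasSum_one_div_tanhPole_pow (by decide) hasSum_zeta_eight)]
  field_simp
  ring

lemma integrable_of_le_inv_one_add_sq {f : ℝ → ℝ} (hf : Continuous f) {C : ℝ}
    (hC : ∀ z, |f z| * (1 + z ^ 2) ≤ C) : Integrable f := by
  refine (integrable_inv_one_add_sq.const_mul C).mono' hf.aestronglyMeasurable
    (.of_forall fun z => ?_)
  rw [norm_eq_abs, ← div_eq_mul_inv, le_div_iff₀ (by positivity)]
  exact hC z

lemma integrable_tanhRem {j : ℕ} (hj : j ≠ 0) : Integrable (tanhRem j) := by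
  have hs := (summable_one_div_tanhPole_pow (m := 2 * j) (by lia)).mul_left 2
  refine integrable_of_le_inv_one_add_sq (continuous_tanhRem j)
    (C := ∑' k, 2 * (1 / tanhPole k ^ (2 * j))) fun z => ?_
  rw [abs_of_nonneg (tanhRem_nonneg j z), ← le_div_iff₀ (by positivity), ← tsum_div_const]
  refine (summable_tanhRem j z).tsum_le_tsum (fun k => ?_) (hs.div_const _)
  have := one_le_tanhPole k
  have h0 := tanhPole_pos k
  have hle : 1 + z ^ 2 ≤ z ^ 2 + tanhPole k ^ 2 := by nlinarith only [this]
  rw [mul_one_div, div_div]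
  gcongr

lemma integrable_tanhRem_zero_pow : Integrable (fun z => tanhRem 0 z ^ 5) := by
  refine integrable_of_le_inv_one_add_sq ((continuous_tanhRem 0).pow 5) (C := 2) fun z => ?_
  have h0 := tanhRem_nonneg 0 z
  have h1 : tanhRem 0 z ≤ 1 := by
    rw [tanhRem_zero_eq]
    have := tanhRem_nonneg 1 z
    have : 0 ≤ z ^ 2 * tanhRem 1 z := by positivity
    linarith
  have ht := (tanh_sq_lt_one z).le
  rw [tanh_eq_mul_tanhRem] at ht
  rw [abs_of_nonneg (by positivity)]
  calc tanhRem 0 z ^ 5 * (1 + z ^ 2) ≤ tanhRem 0 z ^ 2 * (1 + z ^ 2) := by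
        gcongr ?_ * _
        exact pow_le_pow_of_le_one h0 h1 (by norm_num)
    _ = tanhRem 0 z ^ 2 + (z * tanhRem 0 z) ^ 2 := by ring
    _ ≤ 2 := by nlinarith [pow_le_one₀ h0 h1 (n := 2)]

lemma inv_sq_add_sq_eq {a : ℝ} (ha : 0 < a) (z : ℝ) :
    (z ^ 2 + a ^ 2)⁻¹ = (a ^ 2)⁻¹ * (1 + (a⁻¹ * z) ^ 2)⁻¹ := by
  field_simp
  ring

lemma integral_Ioi_inv_sq_add_sq {a : ℝ} (ha : 0 < a) :
    ∫ z in Set.Ioi (0 : ℝ), (z ^ 2 + a ^ 2)⁻¹ = π / (2 * a) := by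
  simp_rw [inv_sq_add_sq_eq ha]
  rw [integral_const_mul, integral_comp_mul_left_Ioi (fun z => (1 + z ^ 2)⁻¹) 0 (inv_pos.2 ha),
    integral_Ioi_inv_one_add_sq]
  simp
  field_simp

lemma integrable_inv_sq_add_sq {a : ℝ} (ha : 0 < a) :
    Integrable (fun z : ℝ => (z ^ 2 + a ^ 2)⁻¹) := by
  simp_rw [inv_sq_add_sq_eq ha]
  exact (integrable_inv_one_add_sq.comp_mul_left' (inv_ne_zero ha.ne')).const_mul _

lemma integral_tanhRem {j : ℕ} {S : ℝ}
    (hS : HasSum (fun k => 1 / tanhPole k ^ (2 * j + 1)) S) :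
    ∫ z in Set.Ioi (0 : ℝ), tanhRem j z = π * S := by
  have hterm (k : ℕ) (z : ℝ) : 2 / (tanhPole k ^ (2 * j) * (z ^ 2 + tanhPole k ^ 2)) =
      2 / tanhPole k ^ (2 * j) * (z ^ 2 + tanhPole k ^ 2)⁻¹ := by
    rw [← div_div, div_eq_mul_inv (2 / _)]
  have hint (k : ℕ) :
      ∫ z in Set.Ioi (0 : ℝ), 2 / (tanhPole k ^ (2 * j) * (z ^ 2 + tanhPole k ^ 2)) =
        π * (1 / tanhPole k ^ (2 * j + 1)) := by
    have := tanhPole_pos k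
    simp_rw [hterm]
    rw [integral_const_mul, integral_Ioi_inv_sq_add_sq this]
    field_simp
    ring
  unfold tanhRem
  rw [← integral_tsum_of_summable_integral_norm]
  · simp_rw [hint]
    exact (hS.mul_left π).tsum_eq
  · intro k
    simp_rw [hterm]
    exact ((integrable_inv_sq_add_sq (tanhPole_pos k)).const_mul _).integrableOn
  · simp_rw [norm_of_nonneg (tanhRem_term_nonneg _ _ _), hint]
    exact (hS.mul_left π).summable

lemma hasDerivAt_tanh (z : ℝ) : HasDerivAt tanh (1 - tanh z ^ 2) z := by
  have hc := (cosh_pos z).ne'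
  have h := (hasDerivAt_sinh z).div (hasDerivAt_cosh z) hc
  have e : tanh = sinh / cosh := by
    ext x
    simp [tanh_eq_sinh_div_cosh]
  rw [e]
  convert! h using 1
  simp only [Pi.div_apply]
  field_simp

lemma tanh_eq_taylor (z : ℝ) :
    tanh z = z - z ^ 3 / 3 + 2 * z ^ 5 / 15 - 17 * z ^ 7 / 315 + z ^ 9 * tanhRem 4 z := by
  rw [tanh_eq_mul_tanhRem, tanhRem_zero_eq, tanhRem_one_eq, tanhRem_two_eq, tanhRem_three_eq]
  ring

/-- A primitive of `tanh z ^ 5 / z ^ 5 - (70 r₄ - 25 r₃ + r₂)`, where `rⱼ` is `tanhRem j`. -/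
noncomputable def tanhPrimitive (z : ℝ) : ℝ :=
  (35 / 4 * tanh z - 5 / 4 * z * tanh z ^ 2 + 15 / 4 * z ^ 2 * tanh z
    + 5 / 12 * z ^ 2 * tanh z ^ 3 - z ^ 3 * tanh z ^ 2 / 2 - z ^ 3 * tanh z ^ 4 / 4
    - 35 / 4 * z + 5 / 12 * z ^ 3 - 2 / 3 * z ^ 5 + 7 / 9 * z ^ 7) / z ^ 8

lemma hasDerivAt_tanhPrimitive {z : ℝ} (hz : z ≠ 0) :
    HasDerivAt tanhPrimitive
      (tanhRem 0 z ^ 5 - (70 * tanhRem 4 z - 25 * tanhRem 3 z + tanhRem 2 z)) z := by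
  have ht := hasDerivAt_tanh z
  have hi := hasDerivAt_id' z
  have h := ((((((((((ht.const_mul (35 / 4)).sub ((hi.const_mul (5 / 4)).mul (ht.pow 2))).add
    (((hi.pow 2).const_mul (15 / 4)).mul ht)).add
    (((hi.pow 2).const_mul (5 / 12)).mul (ht.pow 3))).sub
    (((hi.pow 3).mul (ht.pow 2)).div_const 2)).sub
    (((hi.pow 3).mul (ht.pow 4)).div_const 4)).sub
    (hi.const_mul (35 / 4))).add ((hi.pow 3).const_mul (5 / 12))).sub
    ((hi.pow 5).const_mul (2 / 3))).add ((hi.pow 7).const_mul (7 / 9))).div (hi.pow 8)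
    (pow_ne_zero 8 hz)
  have h0 : tanhRem 0 z = tanh z / z := by
    rw [tanh_eq_mul_tanhRem]
    field_simp
  have h1 : tanhRem 1 z = (1 - tanhRem 0 z) / z ^ 2 := by
    rw [tanhRem_zero_eq]
    field_simp
    ring
  have h2 : tanhRem 2 z = (1 / 3 - tanhRem 1 z) / z ^ 2 := by
    rw [tanhRem_one_eq]
    field_simp
    ring
  have h3 : tanhRem 3 z = (2 / 15 - tanhRem 2 z) / z ^ 2 := by
    rw [tanhRem_two_eq]
    field_simp
    ring
  have h4 : tanhRem 4 z = (17 / 315 - tanhRem 3 z) / z ^ 2 := by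
    rw [tanhRem_three_eq]
    field_simp
    ring
  convert! h using 1
  rw [h4, h3, h2, h1, h0]
  simp only [Pi.add_apply, Pi.sub_apply, Pi.mul_apply, Pi.pow_apply]
  generalize tanh z = t
  field_simp
  ring

lemma tanhPrimitive_eq (z : ℝ) :
    tanhPrimitive z = z * (311 / 630 - 1312 / 2835 * z ^ 2 + 1423 / 4725 * z ^ 4
      - 62513 / 396900 * z ^ 6 + 28363 / 396900 * z ^ 8 - 56569 / 1984500 * z ^ 10
      + 23 / 2430 * z ^ 12 - 5165471 / 1875352500 * z ^ 14 + 105247 / 156279375 * z ^ 16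
      - 60979 / 468838125 * z ^ 18 + 9826 / 468838125 * z ^ 20 - 83521 / 39382402500 * z ^ 22
      + tanhRem 4 z * (35 / 4 - 5 / 4 * z * (tanh z + (tanh z - z ^ 9 * tanhRem 4 z))
        + 15 / 4 * z ^ 2 + 5 / 12 * z ^ 2 * (tanh z ^ 2 + tanh z * (tanh z - z ^ 9 * tanhRem 4 z)
          + (tanh z - z ^ 9 * tanhRem 4 z) ^ 2)
        - z ^ 3 * (tanh z + (tanh z - z ^ 9 * tanhRem 4 z)) / 2
        - z ^ 3 * (tanh z + (tanh z - z ^ 9 * tanhRem 4 z)) *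
          (tanh z ^ 2 + (tanh z - z ^ 9 * tanhRem 4 z) ^ 2) / 4)) := by
  rcases eq_or_ne z 0 with rfl | hz
  · simp [tanhPrimitive]
  rw [tanhPrimitive, div_eq_iff (by positivity), tanh_eq_taylor]
  ring

lemma continuous_tanhPrimitive : Continuous tanhPrimitive := by
  have h4 := continuous_tanhRem 4
  have ht : Continuous tanh :=
    continuous_iff_continuousAt.2 fun z => (hasDerivAt_tanh z).continuousAt
  rw [funext tanhPrimitive_eq]
  fun_prop

lemma tendsto_tanhPrimitive_atTop : Tendsto tanhPrimitive atTop (𝓝 0) := by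
  have hlim : Tendsto (fun z : ℝ => 40 / z) atTop (𝓝 0) := tendsto_const_nhds.div_atTop tendsto_id
  refine squeeze_zero_norm' ?_ hlim
  filter_upwards [eventually_ge_atTop 1] with z hz
  have h0 : 0 < z := by linarith
  have ht := abs_tanh_lt_one z
  have hle {n : ℕ} (hn : n ≤ 7) : z ^ n ≤ z ^ 7 := pow_le_pow_right₀ hz hn
  have hmul (n m : ℕ) (hn : n ≤ 7) : |z ^ n * tanh z ^ m| ≤ z ^ 7 := by
    rw [abs_mul, abs_pow, abs_pow, abs_of_pos h0]
    exact (mul_le_of_le_one_right (by positivity) (pow_le_one₀ (abs_nonneg _) ht.le)).trans (hle hn)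
  have e1 := abs_le.1 (hmul 0 1 (by decide))
  have e2 := abs_le.1 (hmul 1 2 (by decide))
  have e3 := abs_le.1 (hmul 2 1 (by decide))
  have e4 := abs_le.1 (hmul 2 3 (by decide))
  have e5 := abs_le.1 (hmul 3 2 (by decide))
  have e6 := abs_le.1 (hmul 3 4 (by decide))
  have e7 := hle (n := 1) (by decide)
  have e8 := hle (n := 3) (by decide)
  have e9 := hle (n := 5) (by decide)
  have p3 : 0 < z ^ 3 := by positivity
  have p5 : 0 < z ^ 5 := by positivity
  have p7 : 0 < z ^ 7 := by positivity
  simp only [pow_zero, pow_one, one_mul] at e1 e2 e3 e7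
  rw [tanhPrimitive, norm_eq_abs, abs_div, abs_of_pos (by positivity : 0 < z ^ 8),
    div_le_div_iff₀ (by positivity) h0, show 40 * z ^ 8 = 40 * z ^ 7 * z by ring]
  gcongr
  rw [abs_le]
  constructor <;> linarith

lemma integral_tanh_pow_five_div :
    ∫ z in Set.Ioi (0 : ℝ), tanh z ^ 5 / z ^ 5 =
      70 * (∫ z in Set.Ioi (0 : ℝ), tanhRem 4 z) - 25 * (∫ z in Set.Ioi (0 : ℝ), tanhRem 3 z)
        + ∫ z in Set.Ioi (0 : ℝ), tanhRem 2 z := by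
  have i0 := integrable_tanhRem_zero_pow.integrableOn (s := Set.Ioi 0)
  have i4 := ((integrable_tanhRem four_ne_zero).integrableOn (s := Set.Ioi 0)).const_mul 70
  have i3 := ((integrable_tanhRem three_ne_zero).integrableOn (s := Set.Ioi 0)).const_mul 25
  have i2 := (integrable_tanhRem two_ne_zero).integrableOn (s := Set.Ioi 0)
  have i43 : Integrable (fun z => 70 * tanhRem 4 z - 25 * tanhRem 3 z)
    (volume.restrict (Set.Ioi 0)) := i4.sub i3
  have i432 : Integrable (fun z => 70 * tanhRem 4 z - 25 * tanhRem 3 z + tanhRem 2 z)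
    (volume.restrict (Set.Ioi 0)) := i43.add i2
  have h := integral_Ioi_of_hasDerivAt_of_tendsto
    continuous_tanhPrimitive.continuousWithinAt
    (fun z hz => hasDerivAt_tanhPrimitive (ne_of_gt hz))
    (i0.sub i432) tendsto_tanhPrimitive_atTop
  have hA : tanhPrimitive 0 = 0 := by simp [tanhPrimitive]
  have hcongr : ∫ z in Set.Ioi (0 : ℝ), tanh z ^ 5 / z ^ 5 =
      ∫ z in Set.Ioi (0 : ℝ), tanhRem 0 z ^ 5 := by
    refine setIntegral_congr_fun measurableSet_Ioi fun z hz => ?_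
    have : z ≠ 0 := ne_of_gt hz
    simp only [tanh_eq_mul_tanhRem z]
    field_simp
  rw [integral_sub i0 i432, integral_add i43 i2, integral_sub i4 i3,
    integral_const_mul, integral_const_mul, hA] at h
  rw [hcongr]
  linarith

lemma riemannZeta_nat_eq_ofReal {m : ℕ} (hm : 1 < m) :
    riemannZeta m = ((∑' n : ℕ, 1 / (n : ℝ) ^ m : ℝ) : ℂ) := by
  rw [zeta_nat_eq_tsum_of_gt_one hm]
  push_cast
  rfl

theorem stmt_5 :
    (↑(∫ z in Set.Ioi (0:ℝ), Real.tanh z ^ 5 / z ^ 5) : ℂ) = 31 * riemannZeta 5 / (π:ℂ) ^ 4 - 3175 * riemannZeta 7 / (π:ℂ) ^ 6 + 35770 * riemannZeta 9 / (π:ℂ) ^ 8 := by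
  have hS {m : ℕ} (hm : 1 < m) := hasSum_one_div_tanhPole_pow (m := m) (by lia)
    (summable_one_div_nat_pow.2 hm).hasSum
  have z5 := riemannZeta_nat_eq_ofReal (m := 5) (by decide)
  have z7 := riemannZeta_nat_eq_ofReal (m := 7) (by decide)
  have z9 := riemannZeta_nat_eq_ofReal (m := 9) (by decide)
  rw [Nat.cast_ofNat] at z5 z7 z9
  rw [z5, z7, z9, integral_tanh_pow_five_div, integral_tanhRem (j := 4) (hS (by decide)),
    integral_tanhRem (j := 3) (hS (by decide)), integral_tanhRem (j := 2) (hS (by decide))]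
  have hπ : (π : ℂ) ≠ 0 := by exact_mod_cast pi_ne_zero
  generalize ∑' n : ℕ, 1 / (n : ℝ) ^ 5 = A
  generalize ∑' n : ℕ, 1 / (n : ℝ) ^ 7 = B
  generalize ∑' n : ℕ, 1 / (n : ℝ) ^ 9 = C
  push_cast
  field_simp
  ring
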